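/- Let α > 1, p ≥ 1, β > 1/p, and let φ be the Gaussian field φ(x) = ∫_ℝ (1+m²)^{-1/2} e^{imx} dW_m with W a complex Brownian motion, and L(t)φ = ∫ (1+m²)^{-1/2} e^{im²t} e^{imx} dW_m. Then for r = max(p, q) with q > 2 one has ‖⟨t⟩^{-β}⟨x⟩^{-α} L(t)φ‖_{L^r_ω L^p_t L^∞_x} < ∞; in particular ⟨t⟩^{-β}⟨x⟩^{-α}L(t)φ ∈ L^p_t L^∞_x almost surely. -/

import Mathlib

open MeasureTheory ProbabilityTheory
open scoped ENNReal NNReal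

/-- Space-time covariance kernel of the evolved Gaussian field `L(t)φ`:
`K((t,x),(t',x')) = ∫ (1+m²)⁻¹ e^{i(m²(t-t') + m(x-x'))} dm`. -/
noncomputable def Kcov (p q : ℝ × ℝ) : ℂ :=
  ∫ m : ℝ, (((1 + m ^ 2)⁻¹ : ℝ) : ℂ) *
    Complex.exp (Complex.I * ((m ^ 2 * (p.1 - q.1) + m * (p.2 - q.2) : ℝ) : ℂ))

theorem rpow_lintegral_le_mul_lintegral_rpow {X : Type*} [MeasurableSpace X] (μ : Measure X)
    {s : ℝ} (hs : 1 ≤ s) {f : X → ℝ≥0∞} (hf : AEMeasurable f μ) :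
    (∫⁻ x, f x ∂μ) ^ s ≤ μ Set.univ ^ (s - 1) * ∫⁻ x, f x ^ s ∂μ := by
  have hs0 : 0 < s := by linarith
  have h := eLpNorm'_le_eLpNorm'_mul_rpow_measure_univ (μ := μ) one_pos hs hf.aestronglyMeasurable
  simp only [eLpNorm', enorm_eq_self, ENNReal.rpow_one, div_one, one_div] at h
  calc (∫⁻ x, f x ∂μ) ^ s
      ≤ ((∫⁻ x, f x ^ s ∂μ) ^ s⁻¹ * μ Set.univ ^ (1 - s⁻¹)) ^ s := by
        gcongr
    _ = μ Set.univ ^ (s - 1) * ∫⁻ x, f x ^ s ∂μ := by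
        rw [ENNReal.mul_rpow_of_nonneg _ _ hs0.le, ← ENNReal.rpow_mul, ← ENNReal.rpow_mul,
          inv_mul_cancel₀ hs0.ne', ENNReal.rpow_one, sub_mul, inv_mul_cancel₀ hs0.ne', one_mul,
          mul_comm]

theorem enorm_integral_sub_integral_rpow_le {X : Type*} [MeasurableSpace X] (μ ν : Measure X)
    [IsProbabilityMeasure μ] [IsProbabilityMeasure ν] {f : X → ℂ} (hf : Measurable f)
    (hμ : Integrable f μ) (hν : Integrable f ν) {s : ℝ} (hs : 1 ≤ s) :
    ‖∫ x, f x ∂μ - ∫ x, f x ∂ν‖ₑ ^ s ≤ ∫⁻ y, ∫⁻ z, ‖f y - f z‖ₑ ^ s ∂ν ∂μ := by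
  have hm : Measurable fun w : X × X => ‖f w.1 - f w.2‖ₑ := by fun_prop
  have h1 : ∫ x, f x ∂μ - ∫ x, f x ∂ν = ∫ y, ∫ z, (f y - f z) ∂ν ∂μ := by
    have : ∀ y, ∫ z, (f y - f z) ∂ν = f y - ∫ z, f z ∂ν := fun y => by
      rw [integral_sub (integrable_const _) hν]; simp
    simp_rw [this]
    rw [integral_sub hμ (integrable_const _)]; simp
  have h2 : ‖∫ x, f x ∂μ - ∫ x, f x ∂ν‖ₑ ≤ ∫⁻ y, ∫⁻ z, ‖f y - f z‖ₑ ∂ν ∂μ := by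
    rw [h1]
    refine (enorm_integral_le_lintegral_enorm _).trans ?_
    exact lintegral_mono fun y => enorm_integral_le_lintegral_enorm _
  calc _ ≤ (∫⁻ y, ∫⁻ z, ‖f y - f z‖ₑ ∂ν ∂μ) ^ s := by gcongr
    _ ≤ ∫⁻ y, (∫⁻ z, ‖f y - f z‖ₑ ∂ν) ^ s ∂μ := by
        simpa using rpow_lintegral_le_mul_lintegral_rpow μ hs
          hm.lintegral_prod_right'.aemeasurable
    _ ≤ _ := by
        refine lintegral_mono fun y => ?_
        simpa using rpow_lintegral_le_mul_lintegral_rpow ν hs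
          (f := fun z => ‖f y - f z‖ₑ) (by fun_prop)

theorem lintegral_weight_rpow_lt_top {a s : ℝ} (h : 1 < a * s) (hs : 0 ≤ s) :
    ∫⁻ t : ℝ, ENNReal.ofReal (Real.sqrt (1 + t ^ 2) ^ (-a)) ^ s < ⊤ := by
  have hi := (integrable_rpow_neg_one_add_norm_sq (E := ℝ) (μ := volume) (r := a * s)
    (by simpa using h)).lintegral_lt_top
  convert hi using 3 with t
  have h0 : (0 : ℝ) ≤ 1 + t ^ 2 := by positivity
  rw [ENNReal.ofReal_rpow_of_nonneg (by positivity) hs, Real.sqrt_eq_rpow, ← Real.rpow_mul h0,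
    ← Real.rpow_mul h0, Real.norm_eq_abs, sq_abs]
  congr 2; ring

theorem one_sub_cos_le_two_mul_abs_rpow (θ : ℝ) :
    1 - Real.cos θ ≤ 2 * |θ| ^ (1 / 2 : ℝ) := by
  rcases le_total |θ| 1 with h | h
  · have h1 := Real.one_sub_sq_div_two_le_cos (x := θ)
    have h2 : |θ| ^ (2 : ℝ) ≤ |θ| ^ (1 / 2 : ℝ) :=
      Real.rpow_le_rpow_of_exponent_ge' (abs_nonneg _) h (by norm_num) (by norm_num)
    have h3 : |θ| ^ (2 : ℝ) = θ ^ 2 := by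
      rw [Real.rpow_two, sq_abs]
    have h4 : 0 ≤ θ ^ 2 := sq_nonneg θ
    linarith
  · have h1 := Real.neg_one_le_cos θ
    have h2 : 1 ≤ |θ| ^ (1 / 2 : ℝ) := Real.one_le_rpow h (by norm_num)
    linarith

theorem integrable_one_add_sq_rpow_mul_abs :
    Integrable fun m : ℝ => (1 + m ^ 2)⁻¹ * |m| ^ (1 / 2 : ℝ) := by
  have hi := integrable_rpow_neg_one_add_norm_sq (E := ℝ) (μ := volume) (r := 3 / 2)
    (by norm_num)
  refine hi.mono' (by fun_prop) (.of_forall fun m => ?_)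
  have h0 : (0 : ℝ) < 1 + m ^ 2 := by positivity
  have h1 : |m| ^ (1 / 2 : ℝ) ≤ (1 + m ^ 2) ^ (1 / 4 : ℝ) := by
    have : |m| ^ (1 / 2 : ℝ) = (m ^ 2) ^ (1 / 4 : ℝ) := by
      rw [← sq_abs m, ← Real.rpow_two, ← Real.rpow_mul (abs_nonneg _)]
      norm_num
    rw [this]
    gcongr
    linarith
  rw [Real.norm_of_nonneg (by positivity), Real.norm_eq_abs, sq_abs]
  calc (1 + m ^ 2)⁻¹ * |m| ^ (1 / 2 : ℝ) ≤ (1 + m ^ 2)⁻¹ * (1 + m ^ 2) ^ (1 / 4 : ℝ) := by gcongr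
    _ = (1 + m ^ 2) ^ (-(3 / 2) / 2 : ℝ) := by
      rw [← Real.rpow_neg_one, ← Real.rpow_add h0]; norm_num

theorem Kcov_self (w : ℝ × ℝ) : Kcov w w = Kcov 0 0 := by
  simp [Kcov]

theorem integrable_Kcov_integrand (v w : ℝ × ℝ) :
    Integrable fun m : ℝ => (((1 + m ^ 2)⁻¹ : ℝ) : ℂ) *
      Complex.exp (Complex.I * ((m ^ 2 * (v.1 - w.1) + m * (v.2 - w.2) : ℝ) : ℂ)) := by
  refine integrable_inv_one_add_sq.mono' (by fun_prop) (.of_forall fun m => ?_)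
  rw [norm_mul, Complex.norm_exp_I_mul_ofReal, Complex.norm_real, mul_one,
    Real.norm_of_nonneg (by positivity)]

theorem Kcov_increment_re_le (t x y : ℝ) :
    (Kcov (t, x) (t, x) - Kcov (t, x) (t, y) - Kcov (t, y) (t, x) + Kcov (t, y) (t, y)).re ≤
      4 * (∫ m : ℝ, (1 + m ^ 2)⁻¹ * |m| ^ (1 / 2 : ℝ)) * |x - y| ^ (1 / 2 : ℝ) := by
  have hre : ∀ v w, (Kcov (t, v) (t, w)).re = ∫ m : ℝ, (1 + m ^ 2)⁻¹ * Real.cos (m * (v - w)) := by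
    intro v w
    rw [Kcov, ← RCLike.re_eq_complex_re, ← integral_re (integrable_Kcov_integrand _ _)]
    congr 1 with m
    rw [RCLike.re_eq_complex_re, Complex.re_ofReal_mul, mul_comm Complex.I,
      Complex.exp_ofReal_mul_I_re]
    simp
  have hint : ∀ v w : ℝ, Integrable fun m : ℝ => (1 + m ^ 2)⁻¹ * Real.cos (m * (v - w)) := by
    intro v w
    refine integrable_inv_one_add_sq.mono' (by fun_prop) (.of_forall fun m => ?_)
    rw [norm_mul, Real.norm_of_nonneg (by positivity)]
    exact mul_le_of_le_one_right (by positivity) (Real.abs_cos_le_one _)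
  simp only [Complex.add_re, Complex.sub_re, hre]
  have hint₂ : Integrable fun m : ℝ => (1 + m ^ 2)⁻¹ * Real.cos (m * (x - x)) -
      (1 + m ^ 2)⁻¹ * Real.cos (m * (x - y)) := (hint x x).sub (hint x y)
  have hint₃ : Integrable fun m : ℝ => (1 + m ^ 2)⁻¹ * Real.cos (m * (x - x)) -
      (1 + m ^ 2)⁻¹ * Real.cos (m * (x - y)) - (1 + m ^ 2)⁻¹ * Real.cos (m * (y - x)) :=
    hint₂.sub (hint y x)
  rw [← integral_sub (hint x x) (hint x y), ← integral_sub hint₂ (hint y x),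
    ← integral_add hint₃ (hint y y), mul_right_comm, ← integral_const_mul]
  refine integral_mono (hint₃.add (hint y y))
    (integrable_one_add_sq_rpow_mul_abs.const_mul _) fun m => ?_
  have h1 := one_sub_cos_le_two_mul_abs_rpow (m * (x - y))
  rw [abs_mul, Real.mul_rpow (abs_nonneg _) (abs_nonneg _)] at h1
  have h2 : Real.cos (m * (y - x)) = Real.cos (m * (x - y)) := by
    rw [← Real.cos_neg]; ring_nf
  simp only [h2, sub_self, mul_zero, Real.cos_zero]
  have h3 : (0 : ℝ) ≤ (1 + m ^ 2)⁻¹ := by positivity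
  nlinarith [mul_le_mul_of_nonneg_left h1 h3]

/-- Every finite linear combination of the values of `u` is a centered circularly-symmetric complex
Gaussian with the variance prescribed by `Kcov`. -/
def HasKcovGaussianLaw {Ω : Type*} [MeasurableSpace Ω] (P : Measure Ω) (u : Ω → ℝ → ℝ → ℂ) : Prop :=
  ∀ (n : ℕ) (c : Fin n → ℂ) (pts : Fin n → ℝ × ℝ),
    Measure.map (fun ω => ∑ i, c i * u ω (pts i).1 (pts i).2) P =
    Measure.map (fun p : ℝ × ℝ =>
        ((Real.sqrt ((∑ i, ∑ j, c i * (starRingEnd ℂ) (c j) * Kcov (pts i) (pts j)).re / 2)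
          : ℝ) : ℂ) * ((p.1 : ℂ) + (p.2 : ℂ) * Complex.I))
      ((gaussianReal 0 1).prod (gaussianReal 0 1))

/-- The absolute moment of order `s` of `X + iY` with `X`, `Y` independent standard Gaussians. -/
noncomputable def complexGaussianMoment (s : ℝ) : ℝ≥0∞ :=
  ∫⁻ w : ℝ × ℝ, ‖(w.1 : ℂ) + (w.2 : ℂ) * Complex.I‖ₑ ^ s
    ∂((gaussianReal 0 1).prod (gaussianReal 0 1))

theorem complexGaussianMoment_lt_top {s : ℝ} (hs : 0 < s) : complexGaussianMoment s < ⊤ := by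
  have hid := memLp_id_gaussianReal' (μ := 0) (v := 1) (ENNReal.ofReal s) (by simp)
  have h1 : MemLp (fun w : ℝ × ℝ => (w.1 : ℂ)) (ENNReal.ofReal s)
      ((gaussianReal 0 1).prod (gaussianReal 0 1)) :=
    (hid.comp_measurePreserving measurePreserving_fst).ofReal
  have h2 : MemLp (fun w : ℝ × ℝ => (w.2 : ℂ) * Complex.I) (ENNReal.ofReal s)
      ((gaussianReal 0 1).prod (gaussianReal 0 1)) :=
    (hid.comp_measurePreserving measurePreserving_snd).ofReal.mul_const _
  have h := lintegral_rpow_enorm_lt_top_of_eLpNorm_lt_top (by simpa using hs) (by simp)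
    (h1.add h2).eLpNorm_lt_top
  simpa [ENNReal.toReal_ofReal hs.le, complexGaussianMoment] using h

theorem lintegral_enorm_rpow_of_map_eq {Ω : Type*} [MeasurableSpace Ω] {P : Measure Ω} {X : Ω → ℂ}
    (hX : Measurable X) {σ s : ℝ} (hσ : 0 ≤ σ) (hs : 0 ≤ s)
    (h : Measure.map X P = Measure.map (fun w : ℝ × ℝ =>
      (σ : ℂ) * ((w.1 : ℂ) + (w.2 : ℂ) * Complex.I)) ((gaussianReal 0 1).prod (gaussianReal 0 1))) :
    ∫⁻ ω, ‖X ω‖ₑ ^ s ∂P = ENNReal.ofReal σ ^ s * complexGaussianMoment s := by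
  have hm : Measurable fun z : ℂ => ‖z‖ₑ ^ s := by fun_prop
  rw [← lintegral_map hm hX, h, lintegral_map hm (by fun_prop), complexGaussianMoment,
    ← lintegral_const_mul _ (by fun_prop)]
  refine lintegral_congr fun w => ?_
  rw [enorm_mul, ENNReal.mul_rpow_of_nonneg _ _ hs, ← ofReal_norm, Complex.norm_real,
    Real.norm_of_nonneg hσ]

section Moments

variable {Ω : Type*} [MeasurableSpace Ω] {P : Measure Ω} {u : Ω → ℝ → ℝ → ℂ}

theorem HasKcovGaussianLaw.exists_lintegral_enorm_rpow_le (hu : HasKcovGaussianLaw P u)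
    (hm : ∀ t x, Measurable fun ω => u ω t x) {s : ℝ} (hs : 0 < s) :
    ∃ C < (⊤ : ℝ≥0∞), ∀ t x, ∫⁻ ω, ‖u ω t x‖ₑ ^ s ∂P ≤ C := by
  refine ⟨ENNReal.ofReal (Real.sqrt ((Kcov 0 0).re / 2)) ^ s * complexGaussianMoment s,
    ENNReal.mul_lt_top (ENNReal.rpow_lt_top_of_nonneg hs.le ENNReal.ofReal_ne_top)
      (complexGaussianMoment_lt_top hs), fun t x => ?_⟩
  refine (lintegral_enorm_rpow_of_map_eq (hm t x) (Real.sqrt_nonneg _) hs.le ?_).le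
  simpa [Kcov_self (t, x)] using hu 1 ![1] ![(t, x)]

theorem HasKcovGaussianLaw.exists_lintegral_enorm_sub_rpow_le (hu : HasKcovGaussianLaw P u)
    (hm : ∀ t x, Measurable fun ω => u ω t x) {s : ℝ} (hs : 0 < s) :
    ∃ C < (⊤ : ℝ≥0∞), ∀ t x y,
      ∫⁻ ω, ‖u ω t x - u ω t y‖ₑ ^ s ∂P ≤ C * ‖x - y‖ₑ ^ (s / 4) := by
  set I : ℝ := ∫ m : ℝ, (1 + m ^ 2)⁻¹ * |m| ^ (1 / 2 : ℝ) with hI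
  have hI0 : 0 ≤ I := integral_nonneg fun m => by positivity
  refine ⟨ENNReal.ofReal (Real.sqrt (2 * I)) ^ s * complexGaussianMoment s,
    ENNReal.mul_lt_top (ENNReal.rpow_lt_top_of_nonneg hs.le ENNReal.ofReal_ne_top)
      (complexGaussianMoment_lt_top hs), fun t x y => ?_⟩
  have hlaw := hu 2 ![1, -1] ![(t, x), (t, y)]
  have hvar : (∑ i, ∑ j, (![1, -1] : Fin 2 → ℂ) i * (starRingEnd ℂ) ((![1, -1] : Fin 2 → ℂ) j) *
      Kcov ((![(t, x), (t, y)] : Fin 2 → ℝ × ℝ) i) ((![(t, x), (t, y)] : Fin 2 → ℝ × ℝ) j)) =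
      Kcov (t, x) (t, x) - Kcov (t, x) (t, y) - Kcov (t, y) (t, x) + Kcov (t, y) (t, y) := by
    simp [Fin.sum_univ_two]
    ring
  have hsum : (fun ω => ∑ i, (![1, -1] : Fin 2 → ℂ) i *
      u ω ((![(t, x), (t, y)] : Fin 2 → ℝ × ℝ) i).1 ((![(t, x), (t, y)] : Fin 2 → ℝ × ℝ) i).2) =
      fun ω => u ω t x - u ω t y := by
    simp [Fin.sum_univ_two, ← sub_eq_add_neg]
  rw [hvar, hsum] at hlaw
  rw [lintegral_enorm_rpow_of_map_eq (X := fun ω => u ω t x - u ω t y)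
    ((hm t x).sub (hm t y)) (Real.sqrt_nonneg _) hs.le hlaw, mul_right_comm]
  gcongr
  have hle := Kcov_increment_re_le t x y
  rw [← hI] at hle
  have hσ : Real.sqrt ((Kcov (t, x) (t, x) - Kcov (t, x) (t, y) - Kcov (t, y) (t, x) +
      Kcov (t, y) (t, y)).re / 2) ≤ Real.sqrt (2 * I) * |x - y| ^ (1 / 4 : ℝ) := by
    refine (Real.sqrt_le_sqrt (y := 2 * I * |x - y| ^ (1 / 2 : ℝ)) (by linarith)).trans_eq ?_
    rw [Real.sqrt_mul (by positivity), Real.sqrt_eq_rpow (|x - y| ^ (1 / 2 : ℝ)),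
      ← Real.rpow_mul (abs_nonneg _)]
    norm_num
  calc _ ≤ (ENNReal.ofReal (Real.sqrt (2 * I) * |x - y| ^ (1 / 4 : ℝ))) ^ s := by gcongr
    _ = _ := by
      rw [ENNReal.ofReal_mul (Real.sqrt_nonneg _), ENNReal.mul_rpow_of_nonneg _ _ hs.le,
        ← ENNReal.ofReal_rpow_of_nonneg (abs_nonneg _) (by norm_num), ← ENNReal.rpow_mul,
        ← Real.enorm_eq_ofReal_abs]
      congr 2; ring

end Moments

theorem exists_ae_enorm_rpow_le_local {s : ℝ} (hs : 1 ≤ s) :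
    ∃ C < (⊤ : ℝ≥0∞), ∀ f : ℝ → ℂ, Measurable f → LocallyIntegrable f →
      ∀ᵐ x, ‖f x‖ₑ ^ s ≤ C * ((∫⁻ y in Metric.closedBall x 1, ‖f y‖ₑ ^ s) +
        ∫⁻ y in Metric.closedBall x 1, ∫⁻ z in Metric.closedBall x 1,
          ‖f y - f z‖ₑ ^ s / ‖y - z‖ₑ ^ 3) := by
  have hs0 : 0 < s := by linarith
  set ρ : ℝ≥0∞ := (2⁻¹ : ℝ≥0∞) ^ (1 / s) with hρ
  have hρ1 : ρ < 1 := ENNReal.rpow_lt_one (by simp) (by positivity)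
  have hc : (1 - ρ)⁻¹ ^ s < ⊤ :=
    ENNReal.rpow_lt_top_of_nonneg hs0.le (ENNReal.inv_ne_top.2 (tsub_pos_of_lt hρ1).ne')
  refine ⟨2 ^ (s - 1) * (1 + 4 * (1 - ρ)⁻¹ ^ s), ENNReal.mul_lt_top
    (ENNReal.rpow_lt_top_of_nonneg (by linarith) (by simp))
    (ENNReal.add_lt_top.2 ⟨by simp, ENNReal.mul_lt_top (by simp) hc⟩), fun f hf hloc => ?_⟩
  filter_upwards [IsUnifLocDoublingMeasure.ae_tendsto_average volume hloc 1] with x hx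
  set F := ∫⁻ y in Metric.closedBall x 1, ‖f y‖ₑ ^ s
  set G := ∫⁻ y in Metric.closedBall x 1, ∫⁻ z in Metric.closedBall x 1,
          ‖f y - f z‖ₑ ^ s / ‖y - z‖ₑ ^ 3
  set B : ℕ → Set ℝ := fun j => Metric.closedBall x ((2⁻¹ : ℝ) ^ j)
  have hvol : ∀ j, volume (B j) = ENNReal.ofReal (2 * (2⁻¹ : ℝ) ^ j) := fun j =>
    Real.volume_closedBall _ _
  have hprob : ∀ j, IsProbabilityMeasure (volume[|B j]) := fun j =>
    cond_isProbabilityMeasure_of_finite (by rw [hvol]; simp)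
      (by rw [hvol]; exact ENNReal.ofReal_ne_top)
  have hsub : ∀ j, B j ⊆ Metric.closedBall x 1 := fun j =>
    Metric.closedBall_subset_closedBall (pow_le_one₀ (by norm_num) (by norm_num))
  have hint : ∀ j, Integrable f (volume[|B j]) := fun j =>
    (hloc.integrableOn_isCompact (isCompact_closedBall x _)).smul_measure
      (by rw [hvol]; simp)
  set a : ℕ → ℂ := fun j => ∫ y, f y ∂(volume[|B j]) with ha
  have hlim : Filter.Tendsto a Filter.atTop (nhds (f x)) := by
    have hδ : Filter.Tendsto (fun j : ℕ => (2⁻¹ : ℝ) ^ j) Filter.atTop (nhdsWithin 0 (Set.Ioi 0)) :=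
      tendsto_pow_atTop_nhdsWithin_zero_of_lt_one (by norm_num) (by norm_num)
    have := hx (fun _ => x) _ hδ (.of_forall fun j => Metric.mem_closedBall_self (by positivity))
    simpa only [average, Measure.restrict_apply_univ, ha, ProbabilityTheory.cond] using this
  have ha0 : ‖a 0‖ₑ ^ s ≤ F := by
    calc ‖a 0‖ₑ ^ s ≤ (∫⁻ y, ‖f y‖ₑ ∂(volume[|B 0])) ^ s := by
          gcongr; exact enorm_integral_le_lintegral_enorm _
      _ ≤ ∫⁻ y, ‖f y‖ₑ ^ s ∂(volume[|B 0]) := by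
          simpa using rpow_lintegral_le_mul_lintegral_rpow (volume[|B 0]) hs
            hf.enorm.aemeasurable
      _ ≤ F := by
          rw [ProbabilityTheory.cond, lintegral_smul_measure, hvol, smul_eq_mul]
          calc _ ≤ 1 * ∫⁻ y in B 0, ‖f y‖ₑ ^ s := by
                gcongr; simp
            _ ≤ F := by rw [one_mul]; exact lintegral_mono_set (hsub 0)
  have hstep : ∀ j, ‖a (j + 1) - a j‖ₑ ^ s ≤ 4 * G * (2⁻¹ : ℝ≥0∞) ^ j := by
    intro j
    refine (enorm_integral_sub_integral_rpow_le _ _ hf (hint (j + 1)) (hint j) hs).trans ?_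
    have hpt : ∀ y ∈ B (j + 1), ∀ z ∈ B j, ‖f y - f z‖ₑ ^ s ≤
        ENNReal.ofReal (2 * (2⁻¹ : ℝ) ^ j) ^ 3 * (‖f y - f z‖ₑ ^ s / ‖y - z‖ₑ ^ 3) := by
      intro y hy z hz
      rcases eq_or_ne y z with rfl | hyz
      · simp [hs0]
      · have hd : ‖y - z‖ₑ ≤ ENNReal.ofReal (2 * (2⁻¹ : ℝ) ^ j) := by
          rw [Real.enorm_eq_ofReal_abs]
          refine ENNReal.ofReal_le_ofReal ?_
          have h1 : |y - x| ≤ (2⁻¹ : ℝ) ^ (j + 1) := hy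
          have h2 : |z - x| ≤ (2⁻¹ : ℝ) ^ j := hz
          have h3 : (2⁻¹ : ℝ) ^ (j + 1) ≤ (2⁻¹ : ℝ) ^ j :=
            pow_le_pow_of_le_one (by norm_num) (by norm_num) (Nat.le_succ j)
          have h4 := abs_sub_le y x z
          rw [abs_sub_comm x z] at h4
          linarith
        have h0 : ‖y - z‖ₑ ≠ 0 := by simpa [sub_eq_zero] using hyz
        calc ‖f y - f z‖ₑ ^ s = ‖y - z‖ₑ ^ 3 * (‖f y - f z‖ₑ ^ s / ‖y - z‖ₑ ^ 3) :=
              (ENNReal.mul_div_cancel (pow_ne_zero _ h0) (by simp)).symm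
          _ ≤ _ := by gcongr
    simp only [ProbabilityTheory.cond, lintegral_smul_measure, hvol, smul_eq_mul]
    have hmeas : Measurable fun w : ℝ × ℝ => ‖f w.1 - f w.2‖ₑ ^ s / ‖w.1 - w.2‖ₑ ^ 3 := by
      fun_prop
    set D := ENNReal.ofReal (2 * (2⁻¹ : ℝ) ^ j) with hDdef
    set D' := ENNReal.ofReal (2 * (2⁻¹ : ℝ) ^ (j + 1)) with hDdef'
    have hconst : D'⁻¹ * (D⁻¹ * D ^ 3) = 4 * (2⁻¹ : ℝ≥0∞) ^ j := by
      have h0 : (0 : ℝ) < 2⁻¹ ^ j := by positivity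
      have h4 : (4 : ℝ≥0∞) * (2⁻¹ : ℝ≥0∞) ^ j = ENNReal.ofReal (4 * (2⁻¹ : ℝ) ^ j) := by
        rw [ENNReal.ofReal_mul (by norm_num), ENNReal.ofReal_pow (by norm_num),
          ENNReal.ofReal_inv_of_pos (by norm_num)]
        simp
      rw [h4, hDdef, hDdef', ← ENNReal.ofReal_inv_of_pos (by positivity),
        ← ENNReal.ofReal_inv_of_pos (by positivity), ← ENNReal.ofReal_pow (by positivity),
        ← ENNReal.ofReal_mul (by positivity), ← ENNReal.ofReal_mul (by positivity)]
      congr 1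
      rw [pow_succ (2⁻¹ : ℝ) j]
      field_simp
      norm_num
    calc D'⁻¹ * ∫⁻ y in B (j + 1), D⁻¹ * ∫⁻ z in B j, ‖f y - f z‖ₑ ^ s
        ≤ D'⁻¹ * ∫⁻ y in B (j + 1), D⁻¹ * ∫⁻ z in B j,
            D ^ 3 * (‖f y - f z‖ₑ ^ s / ‖y - z‖ₑ ^ 3) := by
          gcongr D'⁻¹ * ?_
          refine setLIntegral_mono' measurableSet_closedBall fun y hy => ?_
          gcongr D⁻¹ * ?_
          exact setLIntegral_mono' measurableSet_closedBall fun z hz => hpt y hy z hz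
      _ = D'⁻¹ * (D⁻¹ * (D ^ 3 * ∫⁻ y in B (j + 1), ∫⁻ z in B j,
            ‖f y - f z‖ₑ ^ s / ‖y - z‖ₑ ^ 3)) := by
          have hin : ∀ y, ∫⁻ z in B j, D ^ 3 * (‖f y - f z‖ₑ ^ s / ‖y - z‖ₑ ^ 3) =
              D ^ 3 * ∫⁻ z in B j, ‖f y - f z‖ₑ ^ s / ‖y - z‖ₑ ^ 3 := fun y =>
            lintegral_const_mul _ (by fun_prop)
          simp_rw [hin]
          rw [lintegral_const_mul _ (hmeas.lintegral_prod_right'.const_mul _),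
            lintegral_const_mul _ hmeas.lintegral_prod_right']
      _ ≤ D'⁻¹ * (D⁻¹ * (D ^ 3 * G)) := by
          gcongr
          refine (lintegral_mono_set (hsub (j + 1))).trans (lintegral_mono fun y => ?_)
          exact lintegral_mono_set (hsub j)
      _ = 4 * G * (2⁻¹ : ℝ≥0∞) ^ j := by
          rw [mul_right_comm, ← hconst]; ring
  have hstep' : ∀ j, edist (a j) (a (j + 1)) ≤ (4 * G) ^ (1 / s) * ρ ^ j := by
    intro j
    rw [edist_comm, edist_eq_enorm_sub]
    have h := ENNReal.rpow_le_rpow (hstep j) (z := 1 / s) (by positivity)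
    rw [← ENNReal.rpow_mul, mul_one_div_cancel hs0.ne', ENNReal.rpow_one,
      ENNReal.mul_rpow_of_nonneg _ _ (by positivity)] at h
    refine h.trans_eq ?_
    rw [hρ, ← ENNReal.rpow_natCast, ← ENNReal.rpow_natCast, ← ENNReal.rpow_mul,
      ← ENNReal.rpow_mul, mul_comm (1 / s)]
  have hbound : ‖f x‖ₑ ≤ ‖a 0‖ₑ + (4 * G) ^ (1 / s) * (1 - ρ)⁻¹ := by
    refine le_of_tendsto hlim.enorm (.of_forall fun n => ?_)
    calc ‖a n‖ₑ = ‖a 0 + (a n - a 0)‖ₑ := by rw [add_sub_cancel]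
      _ ≤ ‖a 0‖ₑ + ‖a n - a 0‖ₑ := enorm_add_le _ _
      _ ≤ _ := by
        gcongr
        rw [← edist_eq_enorm_sub, edist_comm]
        refine (edist_le_range_sum_edist a n).trans ?_
        refine (Finset.sum_le_sum fun j _ => hstep' j).trans ?_
        rw [← Finset.mul_sum, ← ENNReal.tsum_geometric]
        gcongr
        exact ENNReal.sum_le_tsum _
  calc ‖f x‖ₑ ^ s ≤ (‖a 0‖ₑ + (4 * G) ^ (1 / s) * (1 - ρ)⁻¹) ^ s := by gcongr
    _ ≤ 2 ^ (s - 1) * (‖a 0‖ₑ ^ s + ((4 * G) ^ (1 / s) * (1 - ρ)⁻¹) ^ s) :=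
        ENNReal.rpow_add_le_mul_rpow_add_rpow _ _ hs
    _ = 2 ^ (s - 1) * (‖a 0‖ₑ ^ s + 4 * (1 - ρ)⁻¹ ^ s * G) := by
        rw [ENNReal.mul_rpow_of_nonneg _ _ hs0.le, ← ENNReal.rpow_mul, one_div_mul_cancel hs0.ne',
          ENNReal.rpow_one]
        ring
    _ ≤ 2 ^ (s - 1) * ((1 + 4 * (1 - ρ)⁻¹ ^ s) * (F + G)) := by
        gcongr
        rw [add_mul, one_mul, mul_add]
        calc _ ≤ F + 4 * (1 - ρ)⁻¹ ^ s * G := by gcongr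
          _ ≤ (F + G) + (4 * (1 - ρ)⁻¹ ^ s * F + 4 * (1 - ρ)⁻¹ ^ s * G) :=
            add_le_add le_self_add le_add_self
    _ = _ := by rw [mul_assoc]

theorem weight_le_of_abs_sub_le {α x y : ℝ} (hα : 0 ≤ α) (h : |y - x| ≤ 1) :
    Real.sqrt (1 + x ^ 2) ^ (-α) ≤ 2 ^ α * Real.sqrt (1 + y ^ 2) ^ (-α) := by
  have hx : 0 < Real.sqrt (1 + x ^ 2) := by positivity
  have hy : 0 < Real.sqrt (1 + y ^ 2) := by positivity
  have h1 : Real.sqrt (1 + y ^ 2) ≤ 2 * Real.sqrt (1 + x ^ 2) := by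
    refine Real.sqrt_le_iff.2 ⟨by positivity, ?_⟩
    rw [mul_pow, Real.sq_sqrt (by positivity)]
    have := abs_le.1 h
    nlinarith [sq_nonneg (y - x - x), sq_nonneg (x - 1), sq_nonneg (x + 1)]
  have h2 : 2⁻¹ * Real.sqrt (1 + y ^ 2) ≤ Real.sqrt (1 + x ^ 2) := by linarith
  calc _ ≤ (2⁻¹ * Real.sqrt (1 + y ^ 2)) ^ (-α) :=
        Real.rpow_le_rpow_of_nonpos (by positivity) h2 (by linarith)
    _ = _ := by
        rw [Real.mul_rpow (by norm_num) hy.le, Real.inv_rpow (by norm_num),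
          Real.rpow_neg (by norm_num), inv_inv]

/-- The `s`-th power of the weight `⟨x⟩^{-α}`. -/
noncomputable def bracketWeight (α s x : ℝ) : ℝ≥0∞ :=
  ENNReal.ofReal (Real.sqrt (1 + x ^ 2) ^ (-α)) ^ s

@[fun_prop]
theorem measurable_bracketWeight (α s : ℝ) : Measurable (bracketWeight α s) := by
  unfold bracketWeight
  fun_prop

theorem bracketWeight_le_mul {α s x y : ℝ} (hα : 0 ≤ α) (hs : 0 ≤ s) (h : |y - x| ≤ 1) :
    bracketWeight α s x ≤ ENNReal.ofReal (2 ^ α) ^ s * bracketWeight α s y := by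
  rw [bracketWeight, bracketWeight, ← ENNReal.mul_rpow_of_nonneg _ _ hs,
    ← ENNReal.ofReal_mul (by positivity)]
  gcongr
  exact weight_le_of_abs_sub_le hα h

theorem bracketWeight_ne_zero (α s x : ℝ) : bracketWeight α s x ≠ 0 := by
  have h : 0 < Real.sqrt (1 + x ^ 2) ^ (-α) := by positivity
  exact (ENNReal.rpow_pos (by simpa using h) ENNReal.ofReal_ne_top).ne'

/-- A weighted fractional Sobolev energy of `f`, with differences of step at most `2`. -/
noncomputable def weightedEnergy (α s : ℝ) (f : ℝ → ℂ) : ℝ≥0∞ :=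
  (∫⁻ y, bracketWeight α s y * ‖f y‖ₑ ^ s) +
    ∫⁻ y, ∫⁻ h in Metric.closedBall 0 2,
      bracketWeight α s y * (‖f y - f (y + h)‖ₑ ^ s / ‖h‖ₑ ^ 3)

theorem locallyIntegrable_of_weightedEnergy_ne_top {α s : ℝ} (hα : 0 ≤ α) (hs : 1 ≤ s) {f : ℝ → ℂ}
    (hf : Measurable f) (hE : weightedEnergy α s f ≠ ⊤) : LocallyIntegrable f := by
  intro x
  refine ⟨Metric.closedBall x 1, Metric.closedBall_mem_nhds x one_pos,
    hf.aestronglyMeasurable, ?_⟩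
  have h1 : ∫⁻ y in Metric.closedBall x 1, ‖f y‖ₑ ^ s < ⊤ := by
    have h : bracketWeight α s x * ∫⁻ y in Metric.closedBall x 1, ‖f y‖ₑ ^ s < ⊤ := by
      calc _ = ∫⁻ y in Metric.closedBall x 1, bracketWeight α s x * ‖f y‖ₑ ^ s :=
            (lintegral_const_mul _ (by fun_prop)).symm
        _ ≤ ∫⁻ y in Metric.closedBall x 1,
              ENNReal.ofReal (2 ^ α) ^ s * (bracketWeight α s y * ‖f y‖ₑ ^ s) := by
            refine setLIntegral_mono' measurableSet_closedBall fun y hy => ?_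
            rw [← mul_assoc]
            gcongr
            exact bracketWeight_le_mul hα (by linarith) hy
        _ ≤ ∫⁻ y, ENNReal.ofReal (2 ^ α) ^ s * (bracketWeight α s y * ‖f y‖ₑ ^ s) :=
            setLIntegral_le_lintegral _ _
        _ = ENNReal.ofReal (2 ^ α) ^ s * ∫⁻ y, bracketWeight α s y * ‖f y‖ₑ ^ s :=
            lintegral_const_mul _ (by fun_prop)
        _ < ⊤ := ENNReal.mul_lt_top
            (ENNReal.rpow_lt_top_of_nonneg (by linarith) ENNReal.ofReal_ne_top)
            (lt_of_le_of_lt le_self_add hE.lt_top)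
    exact ENNReal.lt_top_of_mul_ne_top_right h.ne (bracketWeight_ne_zero α s x)
  calc ∫⁻ y in Metric.closedBall x 1, ‖f y‖ₑ
      ≤ ∫⁻ y in Metric.closedBall x 1, (1 + ‖f y‖ₑ ^ s) := by
        refine lintegral_mono fun y => ?_
        rcases le_total ‖f y‖ₑ 1 with h | h
        · exact h.trans le_self_add
        · exact (ENNReal.le_rpow_self_of_one_le h hs).trans le_add_self
    _ = volume (Metric.closedBall x 1) + ∫⁻ y in Metric.closedBall x 1, ‖f y‖ₑ ^ s := by
        rw [lintegral_add_left (by fun_prop)]; simp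
    _ < ⊤ := ENNReal.add_lt_top.2 ⟨measure_closedBall_lt_top, h1⟩

theorem exists_ae_bracketWeight_mul_le_weightedEnergy {α s : ℝ} (hα : 0 ≤ α) (hs : 1 ≤ s) :
    ∃ C < (⊤ : ℝ≥0∞), ∀ f : ℝ → ℂ, Measurable f →
      ∀ᵐ x, bracketWeight α s x * ‖f x‖ₑ ^ s ≤ C * weightedEnergy α s f := by
  have hs0 : 0 ≤ s := by linarith
  obtain ⟨C, hC, hmain⟩ := exists_ae_enorm_rpow_le_local hs
  set c : ℝ≥0∞ := ENNReal.ofReal (2 ^ α) ^ s with hc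
  have hctop : c < ⊤ := ENNReal.rpow_lt_top_of_nonneg hs0 ENNReal.ofReal_ne_top
  refine ⟨C * c + 1, ENNReal.add_lt_top.2 ⟨ENNReal.mul_lt_top hC hctop, by simp⟩, fun f hf => ?_⟩
  by_cases hE : weightedEnergy α s f = ⊤
  · simp [hE, ENNReal.mul_top]
  filter_upwards [hmain f hf (locallyIntegrable_of_weightedEnergy_ne_top hα hs hf hE)] with x hx
  have hW : ∀ y ∈ Metric.closedBall x 1, ∀ b : ℝ≥0∞,
      bracketWeight α s x * b ≤ c * (bracketWeight α s y * b) := fun y hy b => by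
    rw [← mul_assoc]
    gcongr
    exact bracketWeight_le_mul hα hs0 hy
  have hmeas : Measurable fun w : ℝ × ℝ => ‖f w.1 - f w.2‖ₑ ^ s / ‖w.1 - w.2‖ₑ ^ 3 := by
    fun_prop
  have hF : bracketWeight α s x * ∫⁻ y in Metric.closedBall x 1, ‖f y‖ₑ ^ s ≤
      c * ∫⁻ y, bracketWeight α s y * ‖f y‖ₑ ^ s := by
    rw [← lintegral_const_mul _ (by fun_prop), ← lintegral_const_mul _ (by fun_prop)]
    exact (setLIntegral_mono' measurableSet_closedBall fun y hy => hW y hy _).trans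
      (setLIntegral_le_lintegral _ _)
  have hshift : ∀ y ∈ Metric.closedBall x 1, ∫⁻ z in Metric.closedBall x 1,
      ‖f y - f z‖ₑ ^ s / ‖y - z‖ₑ ^ 3 ≤
      ∫⁻ h in Metric.closedBall 0 2, ‖f y - f (y + h)‖ₑ ^ s / ‖h‖ₑ ^ 3 := by
    intro y hy
    have hsub : Metric.closedBall x 1 ⊆ Metric.closedBall y 2 :=
      Metric.closedBall_subset_closedBall' (by
        have : dist x y ≤ 1 := by rw [dist_comm]; exact hy
        linarith)
    refine (lintegral_mono_set hsub).trans_eq ?_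
    rw [← lintegral_indicator measurableSet_closedBall,
      ← lintegral_indicator measurableSet_closedBall, ← lintegral_add_left_eq_self _ y]
    refine lintegral_congr fun h => ?_
    by_cases hh : |h| ≤ 2 <;> simp [Set.indicator, hh]
  have hG : bracketWeight α s x * (∫⁻ y in Metric.closedBall x 1, ∫⁻ z in Metric.closedBall x 1,
      ‖f y - f z‖ₑ ^ s / ‖y - z‖ₑ ^ 3) ≤
      c * ∫⁻ y, ∫⁻ h in Metric.closedBall 0 2,
        bracketWeight α s y * (‖f y - f (y + h)‖ₑ ^ s / ‖h‖ₑ ^ 3) := by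
    have hm2 : Measurable fun w : ℝ × ℝ =>
        bracketWeight α s w.1 * (‖f w.1 - f (w.1 + w.2)‖ₑ ^ s / ‖w.2‖ₑ ^ 3) := by
      fun_prop
    rw [← lintegral_const_mul _ hmeas.lintegral_prod_right',
      ← lintegral_const_mul _ hm2.lintegral_prod_right']
    refine (setLIntegral_mono' measurableSet_closedBall fun y hy => ?_).trans
      (setLIntegral_le_lintegral _ _)
    refine (hW y hy _).trans ?_
    dsimp only
    rw [lintegral_const_mul _ (by fun_prop)]
    exact mul_le_mul_right (mul_le_mul_right (hshift y hy) _) _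
  calc _ ≤ bracketWeight α s x * (C * _) := by gcongr
    _ ≤ C * (c * weightedEnergy α s f) := by
        rw [mul_left_comm, weightedEnergy, mul_add, mul_add c]
        exact mul_le_mul_right (add_le_add hF hG) C
    _ ≤ _ := by
        rw [← mul_assoc]
        gcongr
        exact le_self_add

theorem measurable_weightedEnergy {X : Type*} [MeasurableSpace X] (α s : ℝ) {g : X → ℝ → ℂ}
    (hg : Measurable (Function.uncurry g)) : Measurable fun x => weightedEnergy α s (g x) := by
  have h1 : Measurable fun w : X × ℝ => bracketWeight α s w.2 * ‖g w.1 w.2‖ₑ ^ s :=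
    ((measurable_bracketWeight α s).comp measurable_snd).mul (hg.enorm.pow_const s)
  have h2 : Measurable fun w : (X × ℝ) × ℝ => bracketWeight α s w.1.2 *
      (‖g w.1.1 w.1.2 - g w.1.1 (w.1.2 + w.2)‖ₑ ^ s / ‖w.2‖ₑ ^ 3) := by
    have h3 : Measurable fun w : (X × ℝ) × ℝ => g w.1.1 w.1.2 := hg.comp measurable_fst
    have h4 : Measurable fun w : (X × ℝ) × ℝ => g w.1.1 (w.1.2 + w.2) :=
      hg.comp (f := fun w : (X × ℝ) × ℝ => (w.1.1, w.1.2 + w.2)) (by fun_prop)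
    fun_prop
  exact h1.lintegral_prod_right'.add h2.lintegral_prod_right'.lintegral_prod_right'

theorem HasKcovGaussianLaw.exists_lintegral_weightedEnergy_le {Ω : Type*} [MeasurableSpace Ω]
    {P : Measure Ω} [IsProbabilityMeasure P] {u : Ω → ℝ → ℝ → ℂ} (hu : HasKcovGaussianLaw P u)
    (hm : ∀ t, Measurable fun w : Ω × ℝ => u w.1 t w.2) {α s : ℝ} (hs : 12 ≤ s) (hα : 1 < α * s) :
    ∃ C < (⊤ : ℝ≥0∞), ∀ t, ∫⁻ ω, weightedEnergy α s (u ω t) ∂P ≤ C := by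
  have hm' : ∀ t x, Measurable fun ω => u ω t x := fun t x =>
    (hm t).comp (measurable_id.prodMk measurable_const)
  obtain ⟨C₁, hC₁, h₁⟩ := hu.exists_lintegral_enorm_rpow_le hm' (s := s) (by linarith)
  obtain ⟨C₂, hC₂, h₂⟩ := hu.exists_lintegral_enorm_sub_rpow_le hm' (s := s) (by linarith)
  set N := ∫⁻ y, bracketWeight α s y with hN
  have hNtop : N < ⊤ := lintegral_weight_rpow_lt_top hα (by linarith)
  set D : ℝ≥0∞ := C₂ * 2 ^ (s / 4 - 3) * volume (Metric.closedBall (0 : ℝ) 2) with hD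
  have hDtop : D < ⊤ := ENNReal.mul_lt_top (ENNReal.mul_lt_top hC₂
    (ENNReal.rpow_lt_top_of_nonneg (by linarith) (by simp))) measure_closedBall_lt_top
  refine ⟨N * C₁ + N * D, ENNReal.add_lt_top.2 ⟨ENNReal.mul_lt_top hNtop hC₁,
    ENNReal.mul_lt_top hNtop hDtop⟩, fun t => ?_⟩
  have hmt := hm t
  have hA : Measurable fun w : Ω × ℝ => bracketWeight α s w.2 * ‖u w.1 t w.2‖ₑ ^ s := by
    fun_prop
  have hB : Measurable fun w : (Ω × ℝ) × ℝ => bracketWeight α s w.1.2 *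
      (‖u w.1.1 t w.1.2 - u w.1.1 t (w.1.2 + w.2)‖ₑ ^ s / ‖w.2‖ₑ ^ 3) := by
    have h3 : Measurable fun w : (Ω × ℝ) × ℝ => u w.1.1 t w.1.2 := hmt.comp measurable_fst
    have h4 : Measurable fun w : (Ω × ℝ) × ℝ => u w.1.1 t (w.1.2 + w.2) :=
      hmt.comp (f := fun w : (Ω × ℝ) × ℝ => (w.1.1, w.1.2 + w.2)) (by fun_prop)
    fun_prop
  simp only [weightedEnergy]
  rw [lintegral_add_left hA.lintegral_prod_right']
  refine add_le_add ?_ ?_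
  · rw [lintegral_lintegral_swap hA.aemeasurable, hN,
      ← lintegral_mul_const _ (measurable_bracketWeight α s)]
    refine lintegral_mono fun y => ?_
    dsimp only
    rw [lintegral_const_mul _ ((hm' t y).enorm.pow_const s)]
    gcongr
    exact h₁ t y
  · rw [lintegral_lintegral_swap hB.lintegral_prod_right'.aemeasurable, hN,
      ← lintegral_mul_const _ (measurable_bracketWeight α s)]
    refine lintegral_mono fun y => ?_
    have hBy : Measurable fun w : Ω × ℝ => bracketWeight α s y *
        (‖u w.1 t y - u w.1 t (y + w.2)‖ₑ ^ s / ‖w.2‖ₑ ^ 3) :=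
      hB.comp (f := fun w : Ω × ℝ => ((w.1, y), w.2)) (by fun_prop)
    rw [lintegral_lintegral_swap hBy.aemeasurable, hD]
    calc _ ≤ ∫⁻ h in Metric.closedBall (0 : ℝ) 2,
          bracketWeight α s y * (C₂ * 2 ^ (s / 4 - 3)) := by
          refine setLIntegral_mono' measurableSet_closedBall fun h hh => ?_
          have hmd : Measurable fun ω => ‖u ω t y - u ω t (y + h)‖ₑ ^ s :=
            ((hm' t y).sub (hm' t (y + h))).enorm.pow_const s
          simp only [div_eq_mul_inv]
          rw [lintegral_const_mul _ (hmd.mul_const _), lintegral_mul_const _ hmd]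
          gcongr bracketWeight α s y * ?_
          have hle : ‖h‖ₑ ≤ 2 := by
            have : |h| ≤ 2 := by simpa using hh
            rw [Real.enorm_eq_ofReal_abs]
            exact ENNReal.ofReal_le_of_le_toReal (by simpa using this)
          rw [← div_eq_mul_inv]
          refine ENNReal.div_le_of_le_mul ((h₂ t y (y + h)).trans ?_)
          have hnorm : ‖y - (y + h)‖ₑ = ‖h‖ₑ := by
            rw [sub_add_cancel_left, enorm_neg]
          rw [hnorm, mul_assoc]
          gcongr C₂ * ?_
          calc ‖h‖ₑ ^ (s / 4) = ‖h‖ₑ ^ (s / 4 - 3) * ‖h‖ₑ ^ (3 : ℝ) := by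
                rw [← ENNReal.rpow_add_of_nonneg _ _ (by linarith) (by norm_num), sub_add_cancel]
            _ ≤ 2 ^ (s / 4 - 3) * ‖h‖ₑ ^ 3 := by
                rw [← ENNReal.rpow_natCast ‖h‖ₑ 3]
                push_cast
                have : 0 ≤ s / 4 - 3 := by linarith
                gcongr
      _ = _ := by
          rw [setLIntegral_const]; ring

theorem essSup_weight_mul_rpow_le {α β s p t : ℝ} (hs : 1 ≤ s) (hp : 0 ≤ p) {f : ℝ → ℂ} {b : ℝ≥0∞}
    (h : ∀ᵐ x, bracketWeight α s x * ‖f x‖ₑ ^ s ≤ b) :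
    (essSup (fun x : ℝ =>
      ENNReal.ofReal (Real.sqrt (1 + t ^ 2) ^ (-β) * Real.sqrt (1 + x ^ 2) ^ (-α)) *
        (‖f x‖₊ : ℝ≥0∞)) volume) ^ p ≤ bracketWeight β p t * b ^ (p / s) := by
  have hs0 : 0 < s := by linarith
  have h1 : essSup (fun x : ℝ =>
      ENNReal.ofReal (Real.sqrt (1 + t ^ 2) ^ (-β) * Real.sqrt (1 + x ^ 2) ^ (-α)) *
        (‖f x‖₊ : ℝ≥0∞)) volume ≤
      ENNReal.ofReal (Real.sqrt (1 + t ^ 2) ^ (-β)) * b ^ (1 / s) := by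
    refine essSup_le_of_ae_le _ ?_
    filter_upwards [h] with x hx
    rw [ENNReal.ofReal_mul (by positivity), mul_assoc, ← enorm_eq_nnnorm]
    gcongr
    rw [bracketWeight, ← ENNReal.mul_rpow_of_nonneg _ _ hs0.le] at hx
    rwa [one_div, ENNReal.le_rpow_inv_iff hs0]
  calc _ ≤ (ENNReal.ofReal (Real.sqrt (1 + t ^ 2) ^ (-β)) * b ^ (1 / s)) ^ p := by gcongr
    _ = _ := by
      rw [ENNReal.mul_rpow_of_nonneg _ _ hp, ← ENNReal.rpow_mul, bracketWeight]
      congr 2; ring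

/-- Weighted mixed-norm bound for the evolved Gaussian field: if `u(ω,t,x)` is the centered
circularly-symmetric complex Gaussian field with covariance `Kcov` (every finite linear
combination has the corresponding complex Gaussian law), then for `α > 1`, `p ≥ 1`,
`β > 1/p`, `q > 2` and `r = max p q`, the norm
`‖⟨t⟩^{-β}⟨x⟩^{-α} u‖_{L^r_ω L^p_t L^∞_x}` is finite; in particular
`⟨t⟩^{-β}⟨x⟩^{-α} u(ω) ∈ L^p_t L^∞_x` almost surely. -/
theorem stmt19 {Ω : Type*} [MeasurableSpace Ω] (P : Measure Ω) [IsProbabilityMeasure P]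
    (u : Ω → ℝ → ℝ → ℂ)
    (hmeas : Measurable fun p : Ω × ℝ × ℝ => u p.1 p.2.1 p.2.2)
    (hgauss : ∀ (n : ℕ) (c : Fin n → ℂ) (pts : Fin n → ℝ × ℝ),
      Measure.map (fun ω => ∑ i, c i * u ω (pts i).1 (pts i).2) P =
      Measure.map (fun p : ℝ × ℝ =>
          ((Real.sqrt ((∑ i, ∑ j, c i * (starRingEnd ℂ) (c j) * Kcov (pts i) (pts j)).re / 2)
            : ℝ) : ℂ) * ((p.1 : ℂ) + (p.2 : ℂ) * Complex.I))
        ((gaussianReal 0 1).prod (gaussianReal 0 1)))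
    (α p β q : ℝ) (hα : 1 < α) (hp : 1 ≤ p) (hβ : 1 / p < β) (hq : 2 < q) :
    (∫⁻ ω, (∫⁻ t : ℝ, (essSup (fun x : ℝ =>
          ENNReal.ofReal (Real.sqrt (1 + t ^ 2) ^ (-β) * Real.sqrt (1 + x ^ 2) ^ (-α)) *
            (‖u ω t x‖₊ : ℝ≥0∞)) volume) ^ p ∂volume) ^ (max p q / p) ∂P)
        ^ (1 / max p q) < ⊤ ∧
    ∀ᵐ ω ∂P, (∫⁻ t : ℝ, (essSup (fun x : ℝ =>
          ENNReal.ofReal (Real.sqrt (1 + t ^ 2) ^ (-β) * Real.sqrt (1 + x ^ 2) ^ (-α)) *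
            (‖u ω t x‖₊ : ℝ≥0∞)) volume) ^ p ∂volume) < ⊤ := by
  have hu : HasKcovGaussianLaw P u := hgauss
  set r := max p q
  set s := max r 12
  have hpr : p ≤ r := le_max_left _ _
  have hrs : r ≤ s := le_max_left _ _
  have hs12 : 12 ≤ s := le_max_right _ _
  have hp0 : 0 < p := by linarith
  have hs1 : 1 ≤ s := by linarith
  have hβp : 1 < β * p := by rwa [div_lt_iff₀ hp0] at hβ
  obtain ⟨C, hC, hsup⟩ := exists_ae_bracketWeight_mul_le_weightedEnergy (α := α) (by linarith) hs1
  obtain ⟨K, hK, hexp⟩ := hu.exists_lintegral_weightedEnergy_le (α := α) (s := s)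
    (fun t => hmeas.comp (f := fun w : Ω × ℝ => (w.1, t, w.2)) (by fun_prop)) hs12 (by nlinarith)
  have hE : Measurable fun w : Ω × ℝ => C * weightedEnergy α s (u w.1 w.2) :=
    (measurable_weightedEnergy (g := fun w : Ω × ℝ => u w.1 w.2) α s
      (hmeas.comp (f := fun w : (Ω × ℝ) × ℝ => (w.1.1, w.1.2, w.2)) (by fun_prop))).const_mul C
  set ν : Measure ℝ := volume.withDensity (bracketWeight β p) with hν
  have hνtop : ν Set.univ < ⊤ := by
    rw [hν, withDensity_apply _ MeasurableSet.univ, Measure.restrict_univ]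
    exact lintegral_weight_rpow_lt_top hβp hp0.le
  have : IsFiniteMeasure ν := ⟨hνtop⟩
  set I : Ω → ℝ≥0∞ := fun ω => ∫⁻ t, (C * weightedEnergy α s (u ω t)) ^ (p / s) ∂ν with hI
  have hImeas : Measurable I := (hE.pow_const (p / s)).lintegral_prod_right'
  have hle : ∀ ω, (∫⁻ t : ℝ, (essSup (fun x : ℝ =>
      ENNReal.ofReal (Real.sqrt (1 + t ^ 2) ^ (-β) * Real.sqrt (1 + x ^ 2) ^ (-α)) *
        (‖u ω t x‖₊ : ℝ≥0∞)) volume) ^ p ∂volume) ≤ I ω := fun ω => by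
    have hm : Measurable fun t => (C * weightedEnergy α s (u ω t)) ^ (p / s) :=
      (hE.comp (f := fun t => (ω, t)) measurable_prodMk_left).pow_const _
    simp only [hI, hν]
    rw [lintegral_withDensity_eq_lintegral_mul _ (measurable_bracketWeight β p) hm]
    refine lintegral_mono fun t => essSup_weight_mul_rpow_le hs1 hp0.le (hsup _ ?_)
    exact hmeas.comp (f := fun x : ℝ => (ω, t, x)) (by fun_prop)
  have hsp : 1 ≤ s / p := by rw [one_le_div hp0]; exact hpr.trans hrs
  have hIs : ∀ ω, I ω ^ (s / p) ≤
      ν Set.univ ^ (s / p - 1) * ∫⁻ t, C * weightedEnergy α s (u ω t) ∂ν := fun ω => by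
    have hm : Measurable fun t => C * weightedEnergy α s (u ω t) :=
      hE.comp (f := fun t => (ω, t)) measurable_prodMk_left
    have h := rpow_lintegral_le_mul_lintegral_rpow ν hsp (hm.pow_const (p / s)).aemeasurable
    have hps : p / s * (s / p) = 1 := by
      rw [← inv_div s p, inv_mul_cancel₀ (by linarith)]
    simpa only [← ENNReal.rpow_mul, hps, ENNReal.rpow_one] using h
  have hfin : ∫⁻ ω, I ω ^ (s / p) ∂P < ⊤ := by
    calc _ ≤ ∫⁻ ω, ν Set.univ ^ (s / p - 1) * ∫⁻ t, C * weightedEnergy α s (u ω t) ∂ν ∂P :=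
          lintegral_mono hIs
      _ = ν Set.univ ^ (s / p - 1) * ∫⁻ t, ∫⁻ ω, C * weightedEnergy α s (u ω t) ∂P ∂ν := by
          rw [lintegral_const_mul _ hE.lintegral_prod_right',
            lintegral_lintegral_swap hE.aemeasurable]
      _ ≤ ν Set.univ ^ (s / p - 1) * ∫⁻ _, C * K ∂ν := by
          gcongr with t
          rw [lintegral_const_mul' _ _ hC.ne]
          gcongr
          exact hexp t
      _ < ⊤ := by
          rw [lintegral_const]
          exact ENNReal.mul_lt_top (ENNReal.rpow_lt_top_of_nonneg (by linarith) hνtop.ne)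
            (ENNReal.mul_lt_top (ENNReal.mul_lt_top hC hK) hνtop)
  refine ⟨ENNReal.rpow_lt_top_of_nonneg (by positivity) (ne_of_lt ?_), ?_⟩
  · calc _ ≤ ∫⁻ ω, (1 + I ω ^ (s / p)) ∂P := by
          refine lintegral_mono fun ω => ?_
          refine (ENNReal.rpow_le_rpow (hle ω) (by positivity)).trans ?_
          rcases le_total (I ω) 1 with h | h
          · exact (ENNReal.rpow_le_one h (by positivity)).trans le_self_add
          · exact (ENNReal.rpow_le_rpow_of_exponent_le h (by gcongr)).trans le_add_self
      _ = 1 + ∫⁻ ω, I ω ^ (s / p) ∂P := by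
          rw [lintegral_add_left measurable_const]; simp
      _ < ⊤ := ENNReal.add_lt_top.2 ⟨by simp, hfin⟩
  · filter_upwards [ae_lt_top (hImeas.pow_const (s / p)) hfin.ne] with ω hω
    exact (hle ω).trans_lt ((ENNReal.rpow_lt_top_iff_of_pos (by positivity)).1 hω)
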